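/- Let d ≥ 2, r ≥ 2, let A ∈ M_d(ℂ) and let P(z) = z^r − a_0 z^{r−1} − ⋯ − a_{r−1} be a monic polynomial with complex coefficients such that P(A) = 0 (the zero matrix). Then for every integer n ≥ 0 one has A^n = Σ_{s=0}^{r−1} u_{n−s} A_s, where {A_s}_{0≤s≤r−1} is the Hörner system associated to A and {u_n} is the r-generalized Fibonacci sequence associated to P. -/

import Mathlib

/-- Closed form of a Hörner system. -/
theorem horner_system_eq {K R : Type*} [CommRing K] [Ring R] [Algebra K R] (a : ℕ → K) (A : R)
    (H : ℕ → R) (hH0 : H 0 = 1) (hHrec : ∀ s, H (s + 1) = A * H s - a s • 1) (m : ℕ) :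
    H m = A ^ m - ∑ s ∈ Finset.range m, a s • A ^ (m - 1 - s) := by
  induction m with
  | zero => simp [hH0]
  | succ m ih =>
    have hsum : ∑ s ∈ Finset.range m, a s • A ^ (m - s) =
        A * ∑ s ∈ Finset.range m, a s • A ^ (m - 1 - s) := by
      rw [Finset.mul_sum]
      refine Finset.sum_congr rfl fun s hs => ?_
      have hs' : m - s = m - 1 - s + 1 := by
        have := Finset.mem_range.mp hs
        omega
      rw [hs', pow_succ', mul_smul_comm]
    rw [hHrec, ih, Finset.sum_range_succ, Nat.add_sub_cancel, Nat.sub_self, pow_zero, hsum,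
      pow_succ', mul_sub, sub_sub]

/-- Fibonacci–Hörner decomposition of the matrix powers `A^n`. -/
theorem fibonacci_horner_decomposition_of_powers
    (d r : ℕ) (hd : 2 ≤ d) (hr : 2 ≤ r)
    (a : ℕ → ℂ) (A : Matrix (Fin d) (Fin d) ℂ)
    -- P(A) = A^r - a_0 A^{r-1} - ⋯ - a_{r-1} I_d = 0
    (hPA : A ^ r - ∑ s ∈ Finset.range r, a s • A ^ (r - 1 - s) = 0)
    -- Hörner system associated to A : A_0 = I_d, A_{s+1} = A·A_s - a_s I_d
    (H : ℕ → Matrix (Fin d) (Fin d) ℂ)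
    (hH0 : H 0 = 1)
    (hHrec : ∀ s : ℕ, H (s + 1) = A * H s - a s • 1)
    -- r-generalized Fibonacci sequence associated to P
    (u : ℤ → ℂ)
    (hu0 : u 0 = 1)
    (huneg : ∀ n : ℤ, -(r : ℤ) + 1 ≤ n → n < 0 → u n = 0)
    (hurec : ∀ n : ℕ, u ((n : ℤ) + 1) = ∑ j ∈ Finset.range r, a j * u ((n : ℤ) - (j : ℤ)))
    (n : ℕ) :
    A ^ n = ∑ s ∈ Finset.range r, u ((n : ℤ) - (s : ℤ)) • H s := by
  have hHr : H r = 0 := (horner_system_eq a A H hH0 hHrec r).trans hPA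
  induction n with
  | zero =>
    rw [pow_zero, Finset.sum_eq_single_of_mem 0 (Finset.mem_range.mpr (by omega))]
    · simp [hu0, hH0]
    · intro s hs hs0
      have := Finset.mem_range.mp hs
      rw [huneg _ (by omega) (by omega), zero_smul]
  | succ n ih =>
    have hmul (s : ℕ) : A * H s = H (s + 1) + a s • 1 := by rw [hHrec, sub_add_cancel]
    calc A ^ (n + 1)
        = ∑ s ∈ Finset.range r, u ((n : ℤ) - s) • H (s + 1) + u ((n : ℤ) + 1) • H 0 := by
          rw [pow_succ', ih, Finset.mul_sum, hurec, hH0, Finset.sum_smul,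
            ← Finset.sum_add_distrib]
          refine Finset.sum_congr rfl fun s _ => ?_
          rw [mul_smul_comm, hmul, smul_add, smul_smul, mul_comm (a s)]
      _ = ∑ s ∈ Finset.range (r + 1), u (((n + 1 : ℕ) : ℤ) - s) • H s := by
          rw [Finset.sum_range_succ']
          simp
      _ = ∑ s ∈ Finset.range r, u (((n + 1 : ℕ) : ℤ) - s) • H s := by
          rw [Finset.sum_range_succ, hHr, smul_zero, add_zero]
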